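/- Let p be a prime, d ≥ 1, and w : Z_p^d → [0,∞) with Σ_{x ∈ Z_p^d} w(x) = 1. If B ⊆ Z_p^d is a spectrum for L²(w), then Σ_{b ∈ B} |ŵ(x − b)|² = p^{−2d} for every x ∈ Z_p^d. -/

import Mathlib

open Finset

/-- The fixed character `χ(t) = e^{2πi t/p}` of `ℤ/p`. -/
noncomputable def chi (p : ℕ) (t : ZMod p) : ℂ :=
  Complex.exp (2 * Real.pi * Complex.I * (t.val : ℂ) / (p : ℂ))

/-- The dot product on `ℤ_p^d`. -/
def dotp {p d : ℕ} (x y : Fin d → ZMod p) : ZMod p := ∑ i, x i * y i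

/-- The Gabor (time-frequency shifted) function `x ↦ g(x-a) χ(x·b)`. -/
noncomputable def gabor {p d : ℕ} (g : (Fin d → ZMod p) → ℂ) (a b : Fin d → ZMod p) :
    (Fin d → ZMod p) → ℂ :=
  fun x => g (x - a) * chi p (dotp x b)

/-- The inner product of `L²` with counting measure on a finite type. -/
noncomputable def innerC {V : Type*} [Fintype V] (f g : V → ℂ) : ℂ :=
  ∑ x, f x * (starRingEnd ℂ) (g x)

/-- `𝒢(g, A, B)` is an orthonormal basis of `L²(ℤ_p^d)`: the family is orthonormal and
every function is a linear combination of its members. -/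
def IsGaborONB {p d : ℕ} [NeZero p] (g : (Fin d → ZMod p) → ℂ)
    (A B : Finset (Fin d → ZMod p)) : Prop :=
  (∀ a ∈ A, ∀ b ∈ B, ∀ a' ∈ A, ∀ b' ∈ B,
    innerC (gabor g a b) (gabor g a' b') = if a = a' ∧ b = b' then 1 else 0)
  ∧ (∀ f : (Fin d → ZMod p) → ℂ, ∃ c : (Fin d → ZMod p) → (Fin d → ZMod p) → ℂ,
      f = fun x => ∑ a ∈ A, ∑ b ∈ B, c a b * gabor g a b x)

/-- `(E, B)` is a spectral pair: the characters indexed by `B` are pairwise orthogonal in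
`L²(E)` and span it. -/
def IsSpectralPair {p d : ℕ} [NeZero p] (E B : Finset (Fin d → ZMod p)) : Prop :=
  (∀ b ∈ B, ∀ b' ∈ B, b ≠ b' → ∑ x ∈ E, chi p (dotp x (b - b')) = 0)
  ∧ (∀ f : (Fin d → ZMod p) → ℂ, ∃ c : (Fin d → ZMod p) → ℂ,
      ∀ x ∈ E, f x = ∑ b ∈ B, c b * chi p (dotp x b))

/-- `(E, A)` is a tiling pair: `Σ_{a∈A} 1_E(x-a) = 1` for every `x`. -/
def IsTilingPair {p d : ℕ} [NeZero p] (E A : Finset (Fin d → ZMod p)) : Prop :=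
  ∀ x : Fin d → ZMod p, (∑ a ∈ A, if x - a ∈ E then (1 : ℕ) else 0) = 1

/-- The Fourier transform `ĝ(m) = p^{-d} Σ_x χ(-x·m) g(x)` on `ℤ_p^d`. -/
noncomputable def ft {p d : ℕ} [NeZero p] (g : (Fin d → ZMod p) → ℂ)
    (m : Fin d → ZMod p) : ℂ :=
  ((p : ℂ) ^ d)⁻¹ * ∑ x, chi p (-(dotp x m)) * g x

/-- `B` is a spectrum for `L²(w)`: the characters indexed by `B` are pairwise orthogonal
with respect to the weight `w` and every function agrees on the support of `w` with a
linear combination of them. -/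
def IsSpectrumW {p d : ℕ} [NeZero p] (w : (Fin d → ZMod p) → ℝ)
    (B : Finset (Fin d → ZMod p)) : Prop :=
  (∀ b ∈ B, ∀ b' ∈ B, b ≠ b' → ∑ x, chi p (dotp x (b - b')) * (w x : ℂ) = 0)
  ∧ (∀ f : (Fin d → ZMod p) → ℂ, ∃ c : (Fin d → ZMod p) → ℂ,
      ∀ x, w x ≠ 0 → f x = ∑ b ∈ B, c b * chi p (dotp x b))

theorem chi_eq_stdAddChar (p : ℕ) [NeZero p] (t : ZMod p) : chi p t = ZMod.stdAddChar t := by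
  rw [ZMod.stdAddChar_apply, ZMod.toCircle_apply, chi]

theorem chi_zero (p : ℕ) [NeZero p] : chi p 0 = 1 := by
  rw [chi_eq_stdAddChar, AddChar.map_zero_eq_one]

theorem chi_add (p : ℕ) [NeZero p] (s t : ZMod p) : chi p (s + t) = chi p s * chi p t := by
  simp only [chi_eq_stdAddChar, AddChar.map_add_eq_mul]

theorem chi_neg (p : ℕ) [NeZero p] (t : ZMod p) : chi p (-t) = starRingEnd ℂ (chi p t) := by
  simp only [chi_eq_stdAddChar, AddChar.map_neg_eq_conj]

theorem dotp_sub {p d : ℕ} (x y z : Fin d → ZMod p) :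
    dotp x (y - z) = dotp x y + -dotp x z := by
  simp [dotp, mul_add, sum_add_distrib, sub_eq_add_neg]

/-- The character sum `Σ_y χ(y·m) w(y)`: the conjugate Fourier transform of `w`, unnormalized. -/
noncomputable def charSum {p d : ℕ} [NeZero p] (w : (Fin d → ZMod p) → ℝ)
    (m : Fin d → ZMod p) : ℂ :=
  ∑ y, chi p (dotp y m) * (w y : ℂ)

section charSum

variable {p d : ℕ} [NeZero p] (w : (Fin d → ZMod p) → ℝ)

theorem charSum_zero : charSum w 0 = ∑ y, (w y : ℂ) := by
  simp [charSum, dotp, chi_zero]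

theorem charSum_neg (m : Fin d → ZMod p) : charSum w (-m) = starRingEnd ℂ (charSum w m) := by
  have h (y : Fin d → ZMod p) : dotp y (-m) = -dotp y m := by simp [dotp]
  simp only [charSum, map_sum, map_mul, Complex.conj_ofReal, h, chi_neg]

theorem norm_ft_ofReal (m : Fin d → ZMod p) :
    ‖ft (fun y => (w y : ℂ)) m‖ = ((p : ℝ) ^ d)⁻¹ * ‖charSum w m‖ := by
  have h : ft (fun y => (w y : ℂ)) m = ((p : ℂ) ^ d)⁻¹ * starRingEnd ℂ (charSum w m) := by
    simp only [ft, charSum, map_sum, map_mul, Complex.conj_ofReal, chi_neg]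
  rw [h, norm_mul, RCLike.norm_conj, norm_inv, norm_pow, Complex.norm_natCast]

/-- Pairing with `χ(· m)` an expansion of `χ(· x)` that is valid on the support of `w`. -/
theorem charSum_sub_eq_sum {x : Fin d → ZMod p} {B : Finset (Fin d → ZMod p)}
    {c : (Fin d → ZMod p) → ℂ}
    (hc : ∀ y, w y ≠ 0 → chi p (dotp y x) = ∑ b ∈ B, c b * chi p (dotp y b))
    (m : Fin d → ZMod p) : charSum w (x - m) = ∑ b ∈ B, c b * charSum w (b - m) := by
  simp only [charSum, mul_sum]
  rw [sum_comm]
  refine sum_congr rfl fun y _ => ?_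
  by_cases hy : w y = 0
  · simp [hy]
  · simp only [dotp_sub, chi_add]
    rw [hc y hy, sum_mul, sum_mul]
    exact sum_congr rfl fun b _ => by ring

end charSum

/-- If `w ≥ 0`, `Σ_x w(x) = 1` and `B` is a spectrum for `L²(w)`,
then `Σ_{b∈B} |ŵ(x-b)|² = p^{-2d}` for every `x`. -/
theorem sum_sq_fourier_translates_of_spectrum
    (p : ℕ) [Fact p.Prime] (d : ℕ) (hd : 1 ≤ d)
    (w : (Fin d → ZMod p) → ℝ) (hw : ∀ x, 0 ≤ w x) (hw1 : ∑ x, w x = 1)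
    (B : Finset (Fin d → ZMod p)) (hB : IsSpectrumW w B) :
    ∀ x : Fin d → ZMod p,
      ∑ b ∈ B, ‖ft (fun y => (w y : ℂ)) (x - b)‖ ^ 2 = ((p : ℝ) ^ (2 * d))⁻¹ := by
  intro x
  have hW0 : charSum w 0 = 1 := by
    rw [charSum_zero]
    exact_mod_cast hw1
  obtain ⟨c, hc⟩ := hB.2 fun y => chi p (dotp y x)
  have hcoef : ∀ b ∈ B, charSum w (x - b) = c b := by
    intro b hb
    rw [charSum_sub_eq_sum w hc, sum_eq_single_of_mem b hb, sub_self, hW0, mul_one]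
    intro b' hb' hne
    rw [charSum, hB.1 b' hb' b hb hne, mul_zero]
  have hparseval : ∑ b ∈ B, ‖charSum w (x - b)‖ ^ 2 = 1 := by
    have h := charSum_sub_eq_sum w hc x
    rw [sub_self, hW0] at h
    have h' : ((∑ b ∈ B, ‖charSum w (x - b)‖ ^ 2 : ℝ) : ℂ) = 1 := by
      rw [h]
      push_cast
      refine sum_congr rfl fun b hb => ?_
      rw [← neg_sub x b, charSum_neg, hcoef b hb, Complex.mul_conj']
    exact_mod_cast h'
  simp only [norm_ft_ofReal, mul_pow]
  rw [← mul_sum, hparseval, mul_one, inv_pow, ← pow_mul, mul_comm d 2]
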